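/- Let f : E → E satisfy f(0) = 0 and ‖f(x) − f(y)‖ ≤ L_F ‖x − y‖ for all x, y ∈ E, where L_F ≥ 0. Let u : [0,T] → E be continuous with ‖u‖_{β,ρ,−β} < ∞. Then the (Bochner-integral) convolution t ↦ ∫_0^t S_{t−r}(f(u(r))) dr satisfies ‖ t ↦ ∫_0^t S_{t−r}(f(u(r))) dr ‖_{β,ρ,−β} ≤ c_S · L_F · ( 2 K₂(ρ) + K₂(ρ)^{1−β} ) · ‖u‖_{β,ρ,−β}. In particular, since K₂(ρ) → 0 as ρ → ∞, the prefactor can be made arbitrarily small by choosing ρ large. -/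

import Mathlib

/-- The weighted Hölder norm
`‖u‖_{β,ρ,−β} = sup_{t∈[0,T]} e^{−ρ t} ‖u(t)‖
  + sup_{0≤s<t≤T} e^{−ρ t} ‖ι(u(t)) − ι(u(s))‖ / (t−s)^β`. -/
noncomputable def hNorm {E F : Type*} [NormedAddCommGroup E] [NormedSpace ℝ E]
    [NormedAddCommGroup F] [NormedSpace ℝ F]
    (ι : E →L[ℝ] F) (β ρ T : ℝ) (u : ℝ → E) : ℝ :=
  sSup ((fun t => Real.exp (-(ρ * t)) * ‖u t‖) '' Set.Icc 0 T) +
    sSup ((fun p : ℝ × ℝ =>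
        Real.exp (-(ρ * p.2)) * ‖ι (u p.2) - ι (u p.1)‖ / (p.2 - p.1) ^ β) ''
      {p : ℝ × ℝ | 0 ≤ p.1 ∧ p.1 < p.2 ∧ p.2 ≤ T})

/-- Finiteness of the weighted Hölder norm `‖u‖_{β,ρ,−β}`. -/
def hFin {E F : Type*} [NormedAddCommGroup E] [NormedSpace ℝ E]
    [NormedAddCommGroup F] [NormedSpace ℝ F]
    (ι : E →L[ℝ] F) (β ρ T : ℝ) (u : ℝ → E) : Prop :=
  BddAbove ((fun t => Real.exp (-(ρ * t)) * ‖u t‖) '' Set.Icc 0 T) ∧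
    BddAbove ((fun p : ℝ × ℝ =>
        Real.exp (-(ρ * p.2)) * ‖ι (u p.2) - ι (u p.1)‖ / (p.2 - p.1) ^ β) ''
      {p : ℝ × ℝ | 0 ≤ p.1 ∧ p.1 < p.2 ∧ p.2 ≤ T})

theorem integral_exp_const_mul {ρ : ℝ} (hρ : ρ ≠ 0) (a b : ℝ) :
    ∫ r in a..b, Real.exp (ρ * r) = (Real.exp (ρ * b) - Real.exp (ρ * a)) / ρ := by
  have h : ∀ x ∈ Set.uIcc a b,
      HasDerivAt (fun r => Real.exp (ρ * r) / ρ) (Real.exp (ρ * x)) x := by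
    intro x _
    have := (((hasDerivAt_id x).const_mul ρ).exp).div_const ρ
    simpa [hρ] using this
  rw [intervalIntegral.integral_eq_sub_of_hasDerivAt h
    (Continuous.intervalIntegrable (by fun_prop) _ _)]
  ring

/-- A norm bound for an interval integral whose integrand grows at most like `C * exp (ρ * r)`. -/
theorem exp_mul_norm_integral_le {G : Type*} [NormedAddCommGroup G] [NormedSpace ℝ G]
    {ρ C a b : ℝ} (hρ : 0 < ρ) (hab : a ≤ b) (t : ℝ) {g : ℝ → G}
    (hg : ∀ r ∈ Set.Ioc a b, ‖g r‖ ≤ C * Real.exp (ρ * r)) :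
    Real.exp (-(ρ * t)) * ‖∫ r in a..b, g r‖ ≤
      C * ((Real.exp (-(ρ * (t - b))) - Real.exp (-(ρ * (t - a)))) / ρ) := by
  have h := intervalIntegral.norm_integral_le_of_norm_le (μ := MeasureTheory.volume) hab
    (Filter.Eventually.of_forall hg)
    (Continuous.intervalIntegrable (by fun_prop) _ _)
  rw [intervalIntegral.integral_const_mul, integral_exp_const_mul hρ.ne'] at h
  refine (mul_le_mul_of_nonneg_left h (Real.exp_pos _).le).trans_eq ?_
  have e (c : ℝ) : Real.exp (-(ρ * (t - c))) = Real.exp (-(ρ * t)) * Real.exp (ρ * c) := by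
    rw [← Real.exp_add]; ring_nf
  rw [e, e]
  ring

theorem one_sub_exp_div_mono {ρ x y : ℝ} (hρ : 0 < ρ) (hxy : x ≤ y) :
    (1 - Real.exp (-(ρ * x))) / ρ ≤ (1 - Real.exp (-(ρ * y))) / ρ := by
  gcongr

theorem one_sub_exp_div_nonneg {ρ x : ℝ} (hρ : 0 < ρ) (hx : 0 ≤ x) :
    0 ≤ (1 - Real.exp (-(ρ * x))) / ρ := by
  simpa using one_sub_exp_div_mono hρ hx

theorem one_sub_exp_div_le {ρ : ℝ} (hρ : 0 < ρ) (x : ℝ) :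
    (1 - Real.exp (-(ρ * x))) / ρ ≤ x := by
  rw [div_le_iff₀ hρ]
  linarith [Real.add_one_le_exp (-(ρ * x))]

theorem le_rpow_mul_rpow_one_sub {k h K β : ℝ} (hk : 0 ≤ k) (hkh : k ≤ h) (hkK : k ≤ K)
    (h0β : 0 ≤ β) (hβ1 : β ≤ 1) : k ≤ h ^ β * K ^ (1 - β) :=
  calc k = k ^ β * k ^ (1 - β) := by
        rw [← Real.rpow_add_of_nonneg hk h0β (by linarith)]; simp
    _ ≤ h ^ β * K ^ (1 - β) := by
        have := hk.trans hkh
        gcongr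

/-- A strongly continuous, uniformly bounded family of operators is jointly continuous, so that it
may be evaluated along a continuous path. -/
theorem continuousOn_convolution_integrand {E : Type*} [NormedAddCommGroup E] [NormedSpace ℝ E]
    {cS T t : ℝ} {S : ℝ → E →L[ℝ] E} (hcS : 0 ≤ cS)
    (hScont : ∀ x : E, ContinuousOn (fun τ => S τ x) (Set.Icc 0 T))
    (hSbdd : ∀ τ ∈ Set.Icc (0 : ℝ) T, ∀ x : E, ‖S τ x‖ ≤ cS * ‖x‖)
    (ht : t ≤ T) {w : ℝ → E} (hw : ContinuousOn w (Set.Icc 0 T)) :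
    ContinuousOn (fun r => S (t - r) (w r)) (Set.Icc 0 t) := by
  have hJ : ContinuousOn (fun p : E × ℝ => S p.2 p.1) (Set.univ ×ˢ Set.Icc 0 T) := by
    refine continuousOn_prod_of_continuousOn_lipschitzOnWith _ cS.toNNReal
      (fun x _ => hScont x) fun τ hτ => LipschitzOnWith.of_dist_le_mul fun x _ y _ => ?_
    rw [dist_eq_norm, dist_eq_norm, ← map_sub, Real.coe_toNNReal _ hcS]
    exact hSbdd τ hτ _
  refine hJ.comp (f := fun r => (w r, t - r))
    ((hw.mono (Set.Icc_subset_Icc_right ht)).prodMk (by fun_prop)) fun r hr => ?_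
  exact ⟨Set.mem_univ _, by linarith [hr.2], by linarith [hr.1]⟩

/-- The drift convolution `t ↦ ∫_0^t S(t−r) f(u(r)) dr` satisfies
`‖∫_0^· S(·−r) f(u(r)) dr‖_{β,ρ,−β} ≤ c_S L_F (2 K₂(ρ) + K₂(ρ)^{1−β}) ‖u‖_{β,ρ,−β}`
where `K₂(ρ) = (1 − e^{−ρT})/ρ`; in particular the convolution has finite norm. -/
theorem drift_convolution_bound
    {E F : Type*}
    [NormedAddCommGroup E] [NormedSpace ℝ E] [CompleteSpace E]
    [NormedAddCommGroup F] [NormedSpace ℝ F] [CompleteSpace F]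
    (ι : E →L[ℝ] F) (hι : ∀ x : E, ‖ι x‖ ≤ ‖x‖)
    (β cS T ρ : ℝ) (h0β : 0 < β) (hβ1 : β < 1) (hcS : 1 ≤ cS) (hT : 0 < T) (hρ : 0 < ρ)
    (S : ℝ → E →L[ℝ] E)
    (hScont : ∀ x : E, ContinuousOn (fun τ => S τ x) (Set.Icc 0 T))
    (hSbdd : ∀ τ ∈ Set.Icc (0 : ℝ) T, ∀ x : E, ‖S τ x‖ ≤ cS * ‖x‖)
    (hShold : ∀ a b : ℝ, 0 ≤ a → a ≤ b → b ≤ T → ∀ x : E,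
      ‖ι (S b x) - ι (S a x)‖ ≤ cS * (b - a) ^ β * ‖x‖)
    (L_F : ℝ) (hLF : 0 ≤ L_F)
    (f : E → E) (hf0 : f 0 = 0)
    (hfLip : ∀ x y : E, ‖f x - f y‖ ≤ L_F * ‖x - y‖)
    (u : ℝ → E) (hu : ContinuousOn u (Set.Icc 0 T))
    (hufin : hFin ι β ρ T u) :
    hFin ι β ρ T (fun t => ∫ r in (0 : ℝ)..t, S (t - r) (f (u r))) ∧
      hNorm ι β ρ T (fun t => ∫ r in (0 : ℝ)..t, S (t - r) (f (u r))) ≤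
        cS * L_F *
            (2 * ((1 - Real.exp (-(ρ * T))) / ρ) +
              ((1 - Real.exp (-(ρ * T))) / ρ) ^ (1 - β)) *
          hNorm ι β ρ T u := by
  set K := (1 - Real.exp (-(ρ * T))) / ρ with hK
  set v : ℝ → E := fun t => ∫ r in (0 : ℝ)..t, S (t - r) (f (u r)) with hv
  set M := sSup ((fun t => Real.exp (-(ρ * t)) * ‖u t‖) '' Set.Icc 0 T)
  have hcS0 : 0 ≤ cS := by linarith
  have hK0 : 0 ≤ K := one_sub_exp_div_nonneg hρ hT.le
  have huM : ∀ t ∈ Set.Icc 0 T, Real.exp (-(ρ * t)) * ‖u t‖ ≤ M := fun t ht =>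
    le_csSup hufin.1 ⟨t, ht, rfl⟩
  have hM0 : 0 ≤ M := le_trans (by positivity) (huM 0 ⟨le_rfl, hT.le⟩)
  have hMN : M ≤ hNorm ι β ρ T u := by
    refine le_add_of_nonneg_right (Real.sSup_nonneg ?_)
    rintro _ ⟨p, ⟨_, hp, _⟩, rfl⟩
    have := sub_pos.2 hp
    positivity
  have hfu : ∀ r ∈ Set.Icc 0 T, ‖f (u r)‖ ≤ L_F * M * Real.exp (ρ * r) := by
    intro r hr
    have h1 : ‖f (u r)‖ ≤ L_F * ‖u r‖ := by simpa [hf0] using hfLip (u r) 0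
    have h2 : ‖u r‖ ≤ M * Real.exp (ρ * r) := by
      have := mul_le_mul_of_nonneg_right (huM r hr) (Real.exp_pos (ρ * r)).le
      rwa [mul_right_comm, ← Real.exp_add, neg_add_cancel, Real.exp_zero, one_mul] at this
    calc _ ≤ _ := h1
      _ ≤ L_F * (M * Real.exp (ρ * r)) := by gcongr
      _ = _ := by ring
  have hw : ContinuousOn (fun r => f (u r)) (Set.Icc 0 T) := by
    have hfc : Continuous f := by
      refine (LipschitzWith.of_dist_le_mul (K := L_F.toNNReal) fun x y => ?_).continuous
      rw [dist_eq_norm, dist_eq_norm, Real.coe_toNNReal _ hLF]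
      exact hfLip x y
    exact hfc.comp_continuousOn hu
  have hSf : ∀ t ∈ Set.Icc 0 T, ∀ r ∈ Set.Icc 0 t,
      ‖S (t - r) (f (u r))‖ ≤ cS * L_F * M * Real.exp (ρ * r) := by
    intro t ht r hr
    calc _ ≤ cS * ‖f (u r)‖ :=
          hSbdd _ ⟨by linarith [hr.2], by linarith [hr.1, ht.2]⟩ _
      _ ≤ cS * (L_F * M * Real.exp (ρ * r)) := by
          gcongr
          exact hfu r ⟨hr.1, hr.2.trans ht.2⟩
      _ = _ := by ring
  have hint : ∀ t ∈ Set.Icc 0 T, ∀ a b, 0 ≤ a → a ≤ b → b ≤ t →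
      IntervalIntegrable (fun r => S (t - r) (f (u r))) MeasureTheory.volume a b := by
    intro t ht a b ha hab hb
    refine ContinuousOn.intervalIntegrable_of_Icc hab ?_
    exact (continuousOn_convolution_integrand hcS0 hScont hSbdd ht.2 hw).mono
      (Set.Icc_subset_Icc ha hb)
  have hsup : ∀ t ∈ Set.Icc 0 T, Real.exp (-(ρ * t)) * ‖v t‖ ≤ cS * L_F * M * K := by
    intro t ht
    have h := exp_mul_norm_integral_le hρ ht.1 t
      fun r hr => hSf t ht r (Set.Ioc_subset_Icc_self hr)
    simp only [sub_self, mul_zero, neg_zero, Real.exp_zero, sub_zero] at h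
    refine h.trans ?_
    gcongr
    exact one_sub_exp_div_mono hρ ht.2
  have hhol : ∀ p ∈ {p : ℝ × ℝ | 0 ≤ p.1 ∧ p.1 < p.2 ∧ p.2 ≤ T},
      Real.exp (-(ρ * p.2)) * ‖ι (v p.2) - ι (v p.1)‖ / (p.2 - p.1) ^ β ≤
        cS * L_F * M * (K + K ^ (1 - β)) := by
    rintro ⟨s, t⟩ ⟨hs, hst, htT⟩
    dsimp only at hs hst htT ⊢
    have ht : t ∈ Set.Icc 0 T := ⟨hs.trans hst.le, htT⟩
    have hs' : s ∈ Set.Icc 0 T := ⟨hs, hst.le.trans htT⟩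
    have i1 := hint t ht 0 s le_rfl hs hst.le
    have i2 := hint t ht s t hs hst.le le_rfl
    have i3 := hint s hs' 0 s le_rfl hs le_rfl
    have hsplit : ι (v t) - ι (v s) =
        ι (∫ r in s..t, S (t - r) (f (u r))) +
          ∫ r in (0 : ℝ)..s, (ι (S (t - r) (f (u r))) - ι (S (s - r) (f (u r)))) := by
      have e : v t = (∫ r in (0 : ℝ)..s, S (t - r) (f (u r))) +
          ∫ r in s..t, S (t - r) (f (u r)) :=
        (intervalIntegral.integral_add_adjacent_intervals i1 i2).symm
      have e' : (∫ r in (0 : ℝ)..s, (ι (S (t - r) (f (u r))) - ι (S (s - r) (f (u r))))) =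
          ι ((∫ r in (0 : ℝ)..s, S (t - r) (f (u r))) - v s) := by
        rw [hv, ← intervalIntegral.integral_sub i1 i3,
          ← ContinuousLinearMap.intervalIntegral_comp_comm ι (i1.sub i3)]
        simp only [map_sub]
      rw [e', e, map_sub, map_add]
      abel
    have hh : 0 < (t - s) ^ β := Real.rpow_pos_of_pos (sub_pos.2 hst) β
    have hA : Real.exp (-(ρ * t)) * ‖ι (∫ r in s..t, S (t - r) (f (u r)))‖ ≤
        cS * L_F * M * ((t - s) ^ β * K ^ (1 - β)) := by
      have h := exp_mul_norm_integral_le hρ hst.le t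
        fun r hr => hSf t ht r ⟨hs.trans hr.1.le, hr.2⟩
      simp only [sub_self, mul_zero, neg_zero, Real.exp_zero] at h
      calc _ ≤ _ := mul_le_mul_of_nonneg_left (hι _) (Real.exp_pos _).le
        _ ≤ _ := h
        _ ≤ _ := by
          gcongr
          exact le_rpow_mul_rpow_one_sub (one_sub_exp_div_nonneg hρ (sub_pos.2 hst).le)
            (one_sub_exp_div_le hρ _) (one_sub_exp_div_mono hρ (by linarith)) h0β.le hβ1.le
    have hB : Real.exp (-(ρ * t)) *
        ‖∫ r in (0 : ℝ)..s, (ι (S (t - r) (f (u r))) - ι (S (s - r) (f (u r))))‖ ≤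
        cS * L_F * M * ((t - s) ^ β * K) := by
      have h := exp_mul_norm_integral_le (C := cS * (t - s) ^ β * (L_F * M)) hρ hs t
        (g := fun r => ι (S (t - r) (f (u r))) - ι (S (s - r) (f (u r)))) fun r hr => by
          have h := hShold (s - r) (t - r) (by linarith [hr.2]) (by linarith)
            (by linarith [hr.1]) (f (u r))
          rw [sub_sub_sub_cancel_right] at h
          refine h.trans ?_
          rw [mul_assoc _ (L_F * M)]
          gcongr
          exact hfu r ⟨hr.1.le, hr.2.trans hs'.2⟩
      refine h.trans ?_
      have hk : (Real.exp (-(ρ * (t - s))) - Real.exp (-(ρ * (t - 0)))) / ρ ≤ K := by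
        rw [hK]
        gcongr
        · exact Real.exp_le_one_iff.2 (by nlinarith)
        · linarith
      calc _ ≤ cS * (t - s) ^ β * (L_F * M) * K := by gcongr
        _ = _ := by ring
    rw [div_le_iff₀ hh, hsplit]
    calc _ ≤ Real.exp (-(ρ * t)) * (‖ι (∫ r in s..t, S (t - r) (f (u r)))‖ +
          ‖∫ r in (0 : ℝ)..s, (ι (S (t - r) (f (u r))) - ι (S (s - r) (f (u r))))‖) := by
          gcongr
          exact norm_add_le _ _
      _ ≤ _ := by linarith
  refine ⟨⟨⟨_, Set.forall_mem_image.2 hsup⟩, ⟨_, Set.forall_mem_image.2 hhol⟩⟩, ?_⟩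
  calc hNorm ι β ρ T v ≤ cS * L_F * M * K + cS * L_F * M * (K + K ^ (1 - β)) :=
        add_le_add (Real.sSup_le (Set.forall_mem_image.2 hsup) (by positivity))
          (Real.sSup_le (Set.forall_mem_image.2 hhol) (by positivity))
    _ = cS * L_F * (2 * K + K ^ (1 - β)) * M := by ring
    _ ≤ _ := by gcongr
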